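/- arXiv:2007.08101 — 7 statements merged into one kernel-verified Lean document; each statement's English description precedes it below -/
import Mathlib

section
/- Let 𝒫 be a probability measure on the interval [0,1] with moments μ_i = ∫₀¹ α^i d𝒫(α), and let H_{k+1} be its (k+1)×(k+1) Hankel matrix, with rows and columns indexed by 0,…,k and entries (H_{k+1})_{ij} = μ_{i+j}. Then 𝒫 is supported on a set of cardinality at most k if and only if H_{k+1} is singular. -/
open MeasureTheory

lemma aux_int (P : Measure ℝ) [IsProbabilityMeasure P]
    (hsupp : P (Set.Icc (0 : ℝ) 1)ᶜ = 0) (n : ℕ) : Integrable (fun α : ℝ => α ^ n) P := by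
  refine Integrable.of_bound (C := 1) (by fun_prop) ?_
  have h : ∀ᵐ x ∂P, x ∈ Set.Icc (0 : ℝ) 1 := by rw [ae_iff]; exact hsupp
  filter_upwards [h] with x hx
  rw [Real.norm_eq_abs, abs_of_nonneg (pow_nonneg hx.1 n)]
  exact pow_le_one₀ hx.1 hx.2

lemma aux_mulVec (k : ℕ) (P : Measure ℝ) [IsProbabilityMeasure P]
    (hsupp : P (Set.Icc (0 : ℝ) 1)ᶜ = 0) (v : Fin (k + 1) → ℝ) (i : Fin (k + 1)) :
    Matrix.mulVec (Matrix.of fun i j : Fin (k + 1) =>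
        ∫ α : ℝ, α ^ ((i : ℕ) + (j : ℕ)) ∂P) v i
      = ∫ α : ℝ, α ^ (i : ℕ) * ∑ j : Fin (k + 1), v j * α ^ (j : ℕ) ∂P := by
  have : ∀ α : ℝ, α ^ (i : ℕ) * ∑ j : Fin (k + 1), v j * α ^ (j : ℕ)
      = ∑ j : Fin (k + 1), α ^ ((i : ℕ) + (j : ℕ)) * v j := by
    intro α
    rw [Finset.mul_sum]
    exact Finset.sum_congr rfl fun j _ => by ring
  simp_rw [this]
  rw [integral_finsetSum _ fun j _ => (aux_int P hsupp _).mul_const _]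
  simp only [Matrix.mulVec, dotProduct, Matrix.of_apply, integral_mul_const]

/-- A probability measure `P` on `[0,1]` is supported on a set of
cardinality at most `k` iff its `(k+1) × (k+1)` Hankel matrix of moments is singular. -/
theorem hankel_singular_iff_finite_support
    (k : ℕ) (P : Measure ℝ) [IsProbabilityMeasure P]
    (hsupp : P (Set.Icc (0 : ℝ) 1)ᶜ = 0) :
    (∃ S : Finset ℝ, S.card ≤ k ∧ P ((S : Set ℝ))ᶜ = 0) ↔
      (Matrix.of fun i j : Fin (k + 1) =>
        ∫ α : ℝ, α ^ ((i : ℕ) + (j : ℕ)) ∂P).det = 0 := by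
  rw [← Matrix.exists_mulVec_eq_zero_iff]
  constructor
  · rintro ⟨S, hS, hP⟩
    have hm : (∏ s ∈ S, (Polynomial.X - Polynomial.C s)).Monic :=
      Polynomial.monic_prod_of_monic _ _ fun s _ => Polynomial.monic_X_sub_C s
    have hd : (∏ s ∈ S, (Polynomial.X - Polynomial.C s)).natDegree = S.card := by
      simpa using Polynomial.natDegree_prod_of_monic S (fun s => Polynomial.X - Polynomial.C s)
        fun s _ => Polynomial.monic_X_sub_C s
    set p := ∏ s ∈ S, (Polynomial.X - Polynomial.C s) with hp
    refine ⟨fun j => p.coeff j, fun h => ?_, ?_⟩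
    · have h1 := congrFun h ⟨S.card, by omega⟩
      have h2 := hm.coeff_natDegree
      rw [hd] at h2
      simp only [Pi.zero_apply] at h1
      rw [h2] at h1
      exact one_ne_zero h1
    · funext i
      rw [aux_mulVec k P hsupp]
      have h : ∀ᵐ x ∂P, x ∈ (S : Set ℝ) := by rw [ae_iff]; exact hP
      refine integral_eq_zero_of_ae ?_
      filter_upwards [h] with x hx
      have h3 : p.eval x = ∑ j : Fin (k + 1), p.coeff j * x ^ (j : ℕ) := by
        rw [Polynomial.eval_eq_sum_range' (n := k + 1) (by omega), Finset.sum_range]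
      have h4 : p.eval x = 0 := by
        rw [hp, Polynomial.eval_prod]
        exact Finset.prod_eq_zero (Finset.mem_coe.1 hx) (by simp)
      rw [← h3, h4]; simp
  · rintro ⟨v, hv, hM⟩
    set p : Polynomial ℝ := ∑ j : Fin (k + 1), Polynomial.C (v j) * Polynomial.X ^ (j : ℕ) with hp
    have he : ∀ x, p.eval x = ∑ j : Fin (k + 1), v j * x ^ (j : ℕ) := by
      intro x; simp [hp, Polynomial.eval_finsetSum]
    have hc : ∀ i : Fin (k + 1), p.coeff i = v i := by
      intro i
      simp [hp, Polynomial.finsetSum_coeff, Polynomial.coeff_X_pow, Fin.val_inj]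
    have hp0 : p ≠ 0 := by
      intro h
      apply hv
      funext i
      rw [← hc i, h]; simp
    have hdeg : p.natDegree ≤ k := by
      refine Polynomial.natDegree_sum_le_of_forall_le _ _ fun j _ => ?_
      exact (Polynomial.natDegree_C_mul_X_pow_le _ _).trans (by omega)
    have hI : ∀ n : ℕ, Integrable (fun x => x ^ n * p.eval x) P := by
      intro n
      simp_rw [he, Finset.mul_sum]
      refine integrable_finsetSum _ fun j _ => ?_
      refine ((aux_int P hsupp (n + j)).mul_const (v j)).congr (ae_of_all _ fun x => ?_)
      ring
    have hsq : ∀ x, p.eval x ^ 2 = ∑ i : Fin (k + 1), v i * (x ^ (i : ℕ) * p.eval x) := by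
      intro x
      rw [sq]
      conv_lhs => rw [he x, ← he x, he x, Finset.sum_mul, ← he x]
      exact Finset.sum_congr rfl fun j _ => by ring
    have hz : ∫ x, p.eval x ^ 2 ∂P = 0 := by
      simp_rw [hsq]
      rw [integral_finsetSum _ fun j _ => (hI _).const_mul _]
      refine Finset.sum_eq_zero fun i _ => ?_
      have := congrFun hM i
      rw [aux_mulVec k P hsupp] at this
      simp_rw [← he] at this
      rw [integral_const_mul, this]; simp
    have hIs : Integrable (fun x => p.eval x ^ 2) P := by
      simp_rw [hsq]
      exact integrable_finsetSum _ fun j _ => (hI _).const_mul _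
    rw [integral_eq_zero_iff_of_nonneg (fun x => sq_nonneg _) hIs] at hz
    refine ⟨p.roots.toFinset, (Multiset.toFinset_card_le _).trans
      ((Polynomial.card_roots' p).trans hdeg), ?_⟩
    have : ∀ᵐ x ∂P, x ∈ (p.roots.toFinset : Set ℝ) := by
      filter_upwards [hz] with x hx
      have : p.eval x = 0 := by simpa using hx
      simp [hp0, this]
    exact ae_iff.1 this
end

section
/- Let 𝒫 = (α, w) be a k-coin distribution (a mixture 𝒫 = Σ_{j=1}^k w_j δ_{α_j} with distinct α_j ∈ [0,1], positive weights w_j summing to 1) with separation ζ = min_{i≠j} |α_i − α_j|, minimum weight w_min = min_j w_j, and let H_k be its k×k Hankel matrix with entries (H_k)_{ij} = μ_{i+j} for 0 ≤ i,j ≤ k−1, where μ_i = Σ_{j=1}^k w_j α_j^i. Then for every q ∈ ℝ^k whose associated polynomial q̂ is a monic polynomial of degree k' ≤ k−1, one has qᵀ H_k q ≥ (w_min/k) · (ζ/16)^{2k−2} · ‖q‖₂². -/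
open Matrix

lemma aux_prod {ι : Type*} [DecidableEq ι] (a : ι → ℝ) (ha : ∀ j, |a j| ≤ 1) (s : Finset ι) :
    ∀ n : ℕ, ∑ i ∈ Finset.range n,
      |(∏ j ∈ s, (Polynomial.X - Polynomial.C (a j))).coeff i| ≤ 2 ^ s.card := by
  induction s using Finset.induction_on with
  | empty =>
    intro n
    simp only [Finset.prod_empty, Finset.card_empty, pow_zero, Polynomial.coeff_one]
    rcases n with _ | n
    · simp
    · rw [Finset.sum_range_succ']
      simp
  | insert b s hb ih =>
    intro n
    rw [Finset.prod_insert hb, Finset.card_insert_of_notMem hb]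
    generalize (∏ j ∈ s, (Polynomial.X - Polynomial.C (a j))) = p at ih ⊢
    have hab := ha b
    rcases n with _ | n
    · simp
    · have h1 := ih n
      have h2 := ih (n+1)
      have hc : ∀ i, |p.coeff i - a b * p.coeff (i+1)| ≤ |p.coeff i| + |p.coeff (i+1)| := by
        intro i
        refine (abs_sub _ _).trans ?_
        rw [abs_mul]
        nlinarith [abs_nonneg (p.coeff (i+1))]
      have h0 : |a b * p.coeff 0| ≤ |p.coeff 0| := by
        rw [abs_mul]
        nlinarith [abs_nonneg (p.coeff 0)]
      rw [Finset.sum_range_succ'] at h2 ⊢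
      have h3 : ∑ i ∈ Finset.range n, |((Polynomial.X - Polynomial.C (a b)) * p).coeff (i+1)|
          ≤ ∑ i ∈ Finset.range n, |p.coeff i| + ∑ i ∈ Finset.range n, |p.coeff (i+1)| := by
        rw [← Finset.sum_add_distrib]
        apply Finset.sum_le_sum
        intro i _
        rw [sub_mul, Polynomial.coeff_sub, Polynomial.coeff_X_mul, Polynomial.coeff_C_mul]
        exact hc i
      have h4 : |((Polynomial.X - Polynomial.C (a b)) * p).coeff 0| ≤ |p.coeff 0| := by
        rw [sub_mul, Polynomial.coeff_sub, Polynomial.coeff_X_mul_zero, Polynomial.coeff_C_mul,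
          zero_sub, abs_neg]
        exact h0
      rw [pow_succ]
      linarith

lemma aux_basis (k : ℕ) (α : Fin k → ℝ) (hα : ∀ j, |α j| ≤ 1) (ζ : ℝ) (hζ : 0 < ζ)
    (hsep : ∀ i j, i ≠ j → ζ ≤ |α i - α j|) (l : Fin k) (n : ℕ) :
    ζ ^ (k-1) * ∑ i ∈ Finset.range n, |(Lagrange.basis Finset.univ α l).coeff i| ≤ 2 ^ (k-1) := by
  have hcard : (Finset.univ.erase l).card = k - 1 := by
    rw [Finset.card_erase_of_mem (Finset.mem_univ l)]; simp
  have h := aux_prod α hα (Finset.univ.erase l) n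
  rw [hcard] at h
  refine le_trans ?_ h
  rw [Finset.mul_sum]
  apply Finset.sum_le_sum
  intro i _
  unfold Lagrange.basis Lagrange.basisDivisor
  rw [Finset.prod_mul_distrib, ← map_prod, Polynomial.coeff_C_mul, abs_mul, ← mul_assoc]
  apply mul_le_of_le_one_left (abs_nonneg _)
  rw [Finset.prod_inv_distrib, abs_inv, Finset.abs_prod]
  have h5 : ζ ^ (k-1) ≤ ∏ j ∈ Finset.univ.erase l, |α l - α j| := by
    rw [← hcard, ← Finset.prod_const]
    apply Finset.prod_le_prod
    · intros; exact hζ.le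
    · intro j hj
      exact hsep l j (Finset.ne_of_mem_erase hj).symm
  have h6 : 0 < ζ ^ (k-1) := by positivity
  rw [← div_eq_mul_inv]
  exact (div_le_one (h6.trans_le h5)).2 h5

lemma aux_main (k : ℕ) (α : Fin k → ℝ) (hα : ∀ j, |α j| ≤ 1) (ζ : ℝ) (hζ : 0 < ζ)
    (hsep : ∀ i j, i ≠ j → ζ ≤ |α i - α j|) (q : Fin k → ℝ) :
    ζ ^ (k-1) * ∑ i, |q i| ≤ 2 ^ (k-1) * ∑ l, |∑ i, q i * α l ^ (i:ℕ)| := by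
  set p : Polynomial ℝ := ∑ i : Fin k, Polynomial.monomial (i:ℕ) (q i) with hp
  have hcoeff : ∀ i : Fin k, p.coeff i = q i := by
    intro i
    simp [hp, Polynomial.finset_sum_coeff, Polynomial.coeff_monomial, Fin.val_inj]
  have heval : ∀ l, p.eval (α l) = ∑ i, q i * α l ^ (i:ℕ) := by
    intro l
    simp [hp, Polynomial.eval_finset_sum]
  have hdeg : p.degree < (Finset.univ : Finset (Fin k)).card := by
    rw [Polynomial.degree_lt_iff_coeff_zero]
    intro m hm
    simp only [Finset.card_univ, Fintype.card_fin] at hm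
    simp only [hp, Polynomial.finset_sum_coeff, Polynomial.coeff_monomial]
    apply Finset.sum_eq_zero
    intro i _
    rw [if_neg]
    have := i.2
    omega
  have hinj : Set.InjOn α (Finset.univ : Finset (Fin k)) := by
    intro i _ j _ hij
    by_contra hne
    have := hsep i j hne
    rw [hij, sub_self, abs_zero] at this
    linarith
  have hL := Lagrange.eq_interpolate hinj hdeg
  rw [Lagrange.interpolate_apply] at hL
  have hci : ∀ i, |p.coeff i| ≤ ∑ l, |p.eval (α l)| *
      |(Lagrange.basis Finset.univ α l).coeff i| := by
    intro i
    have : p.coeff i = ∑ l, p.eval (α l) * (Lagrange.basis Finset.univ α l).coeff i := by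
      conv_lhs => rw [hL]
      simp [Polynomial.finset_sum_coeff]
    rw [this]
    refine (Finset.abs_sum_le_sum_abs _ _).trans ?_
    simp only [abs_mul, le_refl]
  calc ζ ^ (k-1) * ∑ i, |q i| = ζ ^ (k-1) * ∑ i ∈ Finset.range k, |p.coeff i| := by
        rw [Finset.sum_range]; simp only [hcoeff]
    _ ≤ ζ ^ (k-1) * ∑ i ∈ Finset.range k, ∑ l, |p.eval (α l)| *
      |(Lagrange.basis Finset.univ α l).coeff i| := by
        gcongr with i _
        exact hci i
    _ = ∑ l, |p.eval (α l)| * (ζ ^ (k-1) * ∑ i ∈ Finset.range k,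
      |(Lagrange.basis Finset.univ α l).coeff i|) := by
        rw [Finset.sum_comm, Finset.mul_sum]
        refine Finset.sum_congr rfl fun l _ => ?_
        rw [← Finset.mul_sum]; ring
    _ ≤ ∑ l, |p.eval (α l)| * 2 ^ (k-1) := by
        gcongr with l _
        exact aux_basis k α hα ζ hζ hsep l k
    _ = _ := by
        rw [← Finset.sum_mul, mul_comm]; simp only [heval]

/-- For a `k`-coin distribution with separation `ζ` and minimum weight
`w_min`, and any vector `q ∈ ℝ^k` whose associated polynomial is monic of degree
`k' ≤ k - 1`, one has `qᵀ H_k q ≥ (w_min / k) · (ζ/16)^(2k-2) · ‖q‖₂²`. -/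
theorem hankel_quadratic_form_lower_bound
    (k : ℕ) (hk : 0 < k)
    (α : Fin k → ℝ) (hα : ∀ j, α j ∈ Set.Icc (0 : ℝ) 1)
    (w : Fin k → ℝ) (hw : ∀ j, 0 < w j) (hsum : ∑ j, w j = 1)
    (ζ wmin : ℝ) (hζ : 0 < ζ)
    (hsep : ∀ i j, i ≠ j → ζ ≤ |α i - α j|)
    (hwmin0 : 0 < wmin) (hwmin : ∀ j, wmin ≤ w j)
    (H : Matrix (Fin k) (Fin k) ℝ)
    (hH : ∀ i j, H i j = ∑ l, w l * α l ^ ((i : ℕ) + (j : ℕ)))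
    (q : Fin k → ℝ) (k' : Fin k)
    (hmonic : q k' = 1) (hhigh : ∀ j, k' < j → q j = 0) :
    wmin / k * (ζ / 16) ^ (2 * k - 2) * (∑ j, q j ^ 2) ≤ q ⬝ᵥ H.mulVec q := by
  have hα' : ∀ j, |α j| ≤ 1 := fun j => abs_le.2 ⟨by linarith [(hα j).1], (hα j).2⟩
  have hm := aux_main k α hα' ζ hζ hsep q
  set v : Fin k → ℝ := fun l => ∑ i, q i * α l ^ (i:ℕ) with hv
  have hquad : q ⬝ᵥ H.mulVec q = ∑ l, w l * v l ^ 2 := by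
    simp only [dotProduct, Matrix.mulVec, hH, hv, sq, Finset.sum_mul_sum]
    simp only [Finset.mul_sum, Finset.sum_mul]
    conv_rhs => rw [Finset.sum_comm]
    refine Finset.sum_congr rfl fun i _ => ?_
    rw [Finset.sum_comm]
    refine Finset.sum_congr rfl fun l _ => Finset.sum_congr rfl fun j _ => ?_
    rw [pow_add]; ring
  have hlow : wmin * ∑ l, v l ^ 2 ≤ ∑ l, w l * v l ^ 2 := by
    rw [Finset.mul_sum]
    exact Finset.sum_le_sum fun l _ => mul_le_mul_of_nonneg_right (hwmin l) (sq_nonneg _)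
  have hq2 : ∑ j, q j ^ 2 ≤ (∑ j, |q j|) ^ 2 := by
    have := Finset.sum_sq_le_sq_sum_of_nonneg (s := Finset.univ) (f := fun j => |q j|)
      (fun i _ => abs_nonneg _)
    simpa only [sq_abs] using this
  have hcs : (∑ l, |v l|) ^ 2 ≤ k * ∑ l, v l ^ 2 := by
    have := sq_sum_le_card_mul_sum_sq (s := Finset.univ) (f := fun l => |v l|)
    simpa only [sq_abs, Finset.card_univ, Fintype.card_fin] using this
  have hkey : (ζ / 16) ^ (2 * k - 2) * ∑ j, q j ^ 2 ≤ k * ∑ l, v l ^ 2 := by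
    have e : 2 * k - 2 = (k-1) * 2 := by omega
    have hz : (ζ / 16) ^ (k-1) * ∑ j, |q j| ≤ ∑ l, |v l| := by
      have h2 : (ζ / 16) ^ (k-1) ≤ (ζ / 2) ^ (k-1) := by
        apply pow_le_pow_left₀ (by positivity); linarith
      have h3 : (ζ / 2) ^ (k-1) * ∑ j, |q j| ≤ ∑ l, |v l| := by
        rw [div_pow, div_mul_eq_mul_div, div_le_iff₀ (by positivity), mul_comm (∑ l, |v l|)]
        exact hm
      exact (mul_le_mul_of_nonneg_right h2 (Finset.sum_nonneg fun _ _ => abs_nonneg _)).trans h3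
    calc (ζ / 16) ^ (2 * k - 2) * ∑ j, q j ^ 2
        ≤ (ζ / 16) ^ (2 * k - 2) * (∑ j, |q j|) ^ 2 := by gcongr
      _ = ((ζ / 16) ^ (k-1) * ∑ j, |q j|) ^ 2 := by rw [e, pow_mul, mul_pow]
      _ ≤ (∑ l, |v l|) ^ 2 := by
        apply pow_le_pow_left₀ _ hz
        exact mul_nonneg (by positivity) (Finset.sum_nonneg fun _ _ => abs_nonneg _)
      _ ≤ _ := hcs
  have hkpos : (0:ℝ) < k := by exact_mod_cast hk
  rw [hquad]
  refine le_trans ?_ hlow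
  calc wmin / k * (ζ / 16) ^ (2 * k - 2) * (∑ j, q j ^ 2)
      = wmin / k * ((ζ / 16) ^ (2 * k - 2) * (∑ j, q j ^ 2)) := by ring
    _ ≤ wmin / k * (k * ∑ l, v l ^ 2) := by gcongr
    _ = _ := by field_simp
end

section
/- For k ≥ 2, let Pas ∈ ℝ^{(2k+1)×(2k+1)} be the matrix (with rows and columns indexed from 0) defined by Pas_{ij} = C(j,i)/C(2k,i) if j ≥ i and Pas_{ij} = 0 otherwise, where C(n,r) denotes the binomial coefficient. Then the spectral (operator 2-to-2) norm of Pas satisfies ‖Pas‖₂ ≤ 6^k. -/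
open Matrix

/-- For `k ≥ 2`, the spectral (ℓ₂ → ℓ₂ operator) norm of the
`(2k+1) × (2k+1)` matrix `Pas` with `Pas_{ij} = C(j,i)/C(2k,i)` for `j ≥ i` and `0`
otherwise is at most `6^k`: for every vector `v`, `‖Pas v‖₂ ≤ 6^k ‖v‖₂`. -/
theorem pascal_matrix_operator_norm_bound
    (k : ℕ) (hk : 2 ≤ k)
    (Pas : Matrix (Fin (2 * k + 1)) (Fin (2 * k + 1)) ℝ)
    (hPas : ∀ i j, Pas i j =
      if (i : ℕ) ≤ (j : ℕ)
        then (Nat.choose (j : ℕ) (i : ℕ) : ℝ) / (Nat.choose (2 * k) (i : ℕ) : ℝ)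
        else 0) :
    ∀ v : Fin (2 * k + 1) → ℝ,
      Real.sqrt (∑ i, (Pas.mulVec v i) ^ 2) ≤ 6 ^ k * Real.sqrt (∑ i, (v i) ^ 2) := by
  intro v
  have hn : ((2 * k + 1 : ℕ) : ℝ) ≤ 6 ^ k := by
    have h : ∀ m : ℕ, 2 * m + 1 ≤ 6 ^ m := by
      intro m
      induction m with
      | zero => norm_num
      | succ m ih => rw [pow_succ]; omega
    exact_mod_cast h k
  have hent : ∀ i j, (Pas i j) ^ 2 ≤ 1 := by
    intro i j
    have hpos : (0 : ℝ) < (Nat.choose (2 * k) (i : ℕ) : ℝ) := by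
      exact_mod_cast Nat.choose_pos (by omega)
    have hle : (Nat.choose (j : ℕ) (i : ℕ) : ℝ) ≤ (Nat.choose (2 * k) (i : ℕ) : ℝ) := by
      exact_mod_cast Nat.choose_le_choose _ (by omega)
    rw [hPas]
    split_ifs
    · exact pow_le_one₀ (by positivity) ((div_le_one hpos).2 hle)
    · norm_num
  have hS : 0 ≤ ∑ i, (v i) ^ 2 := Finset.sum_nonneg fun i _ => sq_nonneg _
  have hrow : ∀ i, (Pas.mulVec v i) ^ 2 ≤ ((2 * k + 1 : ℕ) : ℝ) * ∑ i, (v i) ^ 2 := by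
    intro i
    have h1 : (Pas.mulVec v i) ^ 2 ≤ (∑ j, (Pas i j) ^ 2) * ∑ j, (v j) ^ 2 :=
      Finset.sum_mul_sq_le_sq_mul_sq Finset.univ (fun j => Pas i j) v
    have h2 : ∑ j, (Pas i j) ^ 2 ≤ ((2 * k + 1 : ℕ) : ℝ) := by
      calc ∑ j, (Pas i j) ^ 2 ≤ ∑ _j : Fin (2 * k + 1), (1 : ℝ) :=
            Finset.sum_le_sum fun j _ => hent i j
        _ = _ := by simp
    exact h1.trans (mul_le_mul_of_nonneg_right h2 hS)
  have htot : ∑ i, (Pas.mulVec v i) ^ 2 ≤ (6 ^ k) ^ 2 * ∑ i, (v i) ^ 2 := by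
    calc ∑ i, (Pas.mulVec v i) ^ 2
        ≤ ∑ _i : Fin (2 * k + 1), ((2 * k + 1 : ℕ) : ℝ) * ∑ i, (v i) ^ 2 :=
          Finset.sum_le_sum fun i _ => hrow i
      _ = ((2 * k + 1 : ℕ) : ℝ) ^ 2 * ∑ i, (v i) ^ 2 := by
          rw [Finset.sum_const, Finset.card_univ, Fintype.card_fin, nsmul_eq_mul]; ring
      _ ≤ _ := mul_le_mul_of_nonneg_right (pow_le_pow_left₀ (by positivity) hn 2) hS
  calc Real.sqrt (∑ i, (Pas.mulVec v i) ^ 2)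
      ≤ Real.sqrt ((6 ^ k) ^ 2 * ∑ i, (v i) ^ 2) := Real.sqrt_le_sqrt htot
    _ = _ := by rw [Real.sqrt_mul (by positivity), Real.sqrt_sq (by positivity)]
end

section
/- Let 𝒫 be a k-coin distribution with support {α₁,…,α_k} ⊂ [0,1], and let H_{k+1} be its (k+1)×(k+1) Hankel matrix, whose kernel is spanned by a unit vector u₁ (with last coordinate (u₁)_k ≠ 0). Let v be a unit vector in ℝ^{k+1} satisfying ‖u₁ − v‖₂ < ε for some ε > 0. Set q = u₁/|(u₁)_k| and r = v/|(u₁)_k|. Then ‖q − r‖_∞ < 2^k · √(k+1) · ε. -/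
open Matrix

open Polynomial in
lemma coeff_prod_bound {ι : Type*} (s : Finset ι) (α : ι → ℝ)
    (hα : ∀ i, α i ∈ Set.Icc (0 : ℝ) 1) :
    ∀ n, |(∏ i ∈ s, (X - C (α i))).coeff n| ≤ 2 ^ s.card := by
  classical
  induction s using Finset.induction_on with
  | empty =>
    intro n
    simp only [Finset.prod_empty, coeff_one, Finset.card_empty, pow_zero]
    split_ifs <;> simp
  | insert a s ha ih =>
    intro n
    rw [Finset.prod_insert ha, Finset.card_insert_of_notMem ha, sub_mul, coeff_sub, coeff_C_mul]
    have h1 : |(X * ∏ i ∈ s, (X - C (α i))).coeff n| ≤ 2 ^ s.card := by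
      cases n with
      | zero => simp
      | succ m => rw [coeff_X_mul]; exact ih m
    have h2 : |α a * (∏ i ∈ s, (X - C (α i))).coeff n| ≤ 2 ^ s.card := by
      rw [abs_mul, abs_of_nonneg (hα a).1]
      calc _ ≤ 1 * |(∏ i ∈ s, (X - C (α i))).coeff n| :=
            mul_le_mul_of_nonneg_right (hα a).2 (abs_nonneg _)
        _ ≤ _ := by rw [one_mul]; exact ih n
    have h3 := abs_sub ((X * ∏ i ∈ s, (X - C (α i))).coeff n)
      (α a * (∏ i ∈ s, (X - C (α i))).coeff n)
    rw [pow_succ]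
    linarith

open Polynomial in
lemma coeff_bound_of_roots (k : ℕ) (α : Fin k → ℝ) (hα : ∀ i, α i ∈ Set.Icc (0 : ℝ) 1)
    (hinj : Function.Injective α) (u : Fin (k + 1) → ℝ)
    (hroot : ∀ l, ∑ i, u i * α l ^ (i : ℕ) = 0) (i : Fin (k + 1)) :
    |u i| ≤ |u (Fin.last k)| * 2 ^ k := by
  set p : ℝ[X] := ∑ i : Fin (k + 1), C (u i) * X ^ (i : ℕ) with hp
  set P : ℝ[X] := ∏ l, (X - C (α l)) with hP
  have hpc : ∀ j : Fin (k + 1), p.coeff j = u j := by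
    intro j
    simp [hp, finsetSum_coeff, coeff_X_pow, Fin.val_inj]
  have hpbig : ∀ n, k < n → p.coeff n = 0 := by
    intro n hn
    rw [hp, finsetSum_coeff]
    refine Finset.sum_eq_zero fun j _ => ?_
    rw [coeff_C_mul, coeff_X_pow, if_neg (by omega), mul_zero]
  have hdeg : P.natDegree = k := by rw [hP, natDegree_prod_of_monic _ _ (fun l _ => monic_X_sub_C _)]; simp
  have hmon : P.Monic := monic_prod_of_monic _ _ (fun l _ => monic_X_sub_C _)
  have hz : p - C (u (Fin.last k)) * P = 0 := by
    refine Polynomial.eq_zero_of_degree_lt_of_eval_index_eq_zero (s := Finset.univ) (v := α) hinj.injOn ?_ ?_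
    · rw [Finset.card_univ, Fintype.card_fin, degree_lt_iff_coeff_zero]
      intro m hm
      rw [coeff_sub, coeff_C_mul]
      rcases hm.eq_or_lt with rfl | hm
      · have h1 := hpc (Fin.last k)
        have h2 : P.coeff k = 1 := by
          have := hmon.coeff_natDegree
          rwa [hdeg] at this
        rw [Fin.val_last] at h1
        rw [h1, h2]; ring
      · rw [hpbig m hm, coeff_eq_zero_of_natDegree_lt (by omega)]; ring
    · intro l _
      have h1 : p.eval (α l) = 0 := by
        rw [← hroot l, hp]; simp [eval_finset_sum]
      have h2 : P.eval (α l) = 0 := by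
        rw [hP, eval_prod]
        exact Finset.prod_eq_zero (Finset.mem_univ l) (by simp)
      simp [h1, h2]
  rw [← hpc i, sub_eq_zero.mp hz, coeff_C_mul, abs_mul]
  have := coeff_prod_bound Finset.univ α hα i
  rw [Finset.card_univ, Fintype.card_fin] at this
  exact mul_le_mul_of_nonneg_left this (abs_nonneg _)

/-- Let `H` be the Hankel matrix of a `k`-coin distribution, `u₁` a
unit vector spanning its kernel (with last coordinate nonzero), and `v` a unit vector
with `‖u₁ - v‖₂ < ε`.  Setting `q = u₁ / |(u₁)_k|` and `r = v / |(u₁)_k|`, we have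
`‖q - r‖_∞ < 2^k · √(k+1) · ε`.  (The norm on `Fin (k+1) → ℝ` is the sup-norm.) -/
theorem rescaled_kernel_vector_close
    (k : ℕ) (hk : 0 < k)
    (α : Fin k → ℝ) (hα : ∀ i, α i ∈ Set.Icc (0 : ℝ) 1)
    (hinj : Function.Injective α)
    (w : Fin k → ℝ) (hw : ∀ i, 0 < w i) (hsum : ∑ i, w i = 1)
    (H : Matrix (Fin (k + 1)) (Fin (k + 1)) ℝ)
    (hH : ∀ i j, H i j = ∑ l, w l * α l ^ ((i : ℕ) + (j : ℕ)))
    (u₁ : Fin (k + 1) → ℝ) (hker : H.mulVec u₁ = 0) (huunit : ∑ i, (u₁ i) ^ 2 = 1)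
    (hlast : u₁ (Fin.last k) ≠ 0)
    (ε : ℝ) (hε : 0 < ε)
    (v : Fin (k + 1) → ℝ) (hvunit : ∑ i, (v i) ^ 2 = 1)
    (hclose : Real.sqrt (∑ i, (u₁ i - v i) ^ 2) < ε) :
    ‖(fun i => u₁ i / |u₁ (Fin.last k)|) - (fun i => v i / |u₁ (Fin.last k)|)‖ <
      2 ^ k * Real.sqrt (k + 1) * ε := by
  have hroot : ∀ l, ∑ i, u₁ i * α l ^ (i : ℕ) = 0 := by
    have hq : ∑ l, w l * (∑ i, u₁ i * α l ^ (i : ℕ)) ^ 2 = 0 := by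
      have h0 : ∑ i, u₁ i * (H.mulVec u₁) i = 0 := by simp [hker]
      rw [← h0]
      simp only [mulVec, dotProduct, hH, sq, Finset.sum_mul_sum, Finset.mul_sum, Finset.sum_mul]
      rw [Finset.sum_comm]
      refine Finset.sum_congr rfl fun i _ => ?_
      rw [Finset.sum_comm]
      refine Finset.sum_congr rfl fun j _ => ?_
      refine Finset.sum_congr rfl fun l _ => ?_
      ring
    intro l
    have := (Finset.sum_eq_zero_iff_of_nonneg
      (fun l _ => mul_nonneg (hw l).le (sq_nonneg _))).1 hq l (Finset.mem_univ l)
    rcases mul_eq_zero.1 this with h | h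
    · exact absurd h (hw l).ne'
    · exact pow_eq_zero_iff (two_ne_zero) |>.1 h
  have hb := coeff_bound_of_roots k α hα hinj u₁ hroot
  have hcpos : 0 < |u₁ (Fin.last k)| := abs_pos.2 hlast
  set c := |u₁ (Fin.last k)| with hc
  have hs : 1 ≤ c * (2 ^ k * Real.sqrt (k + 1)) := by
    have h1 : (1 : ℝ) ≤ (k + 1) * (c * 2 ^ k) ^ 2 := by
      refine huunit.symm.le.trans ?_
      calc _ ≤ ∑ i : Fin (k + 1), (c * 2 ^ k) ^ 2 := by
            refine Finset.sum_le_sum fun i _ => ?_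
            rw [← sq_abs]
            exact pow_le_pow_left₀ (abs_nonneg _) (hb i) 2
        _ = _ := by simp
    have h2 : (c * (2 ^ k * Real.sqrt (k + 1))) ^ 2 = (k + 1) * (c * 2 ^ k) ^ 2 := by
      have : Real.sqrt ((k : ℝ) + 1) ^ 2 = k + 1 := Real.sq_sqrt (by positivity)
      linear_combination (c * 2 ^ k) ^ 2 * this
    rw [← h2] at h1
    exact (one_le_sq_iff₀ (by positivity)).1 h1
  rw [pi_norm_lt_iff (by positivity)]
  intro i
  have hi : |u₁ i - v i| < ε := by
    refine lt_of_le_of_lt ?_ hclose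
    apply Real.abs_le_sqrt
    exact Finset.single_le_sum (f := fun i => (u₁ i - v i) ^ 2) (fun _ _ => sq_nonneg _)
      (Finset.mem_univ i)
  rw [Pi.sub_apply, ← sub_div, Real.norm_eq_abs, abs_div, abs_of_pos hcpos, div_lt_iff₀ hcpos]
  calc _ < ε := hi
    _ = 1 * ε := (one_mul _).symm
    _ ≤ c * (2 ^ k * Real.sqrt (k + 1)) * ε := mul_le_mul_of_nonneg_right hs hε.le
    _ = _ := by ring
end

section
/- Let w ∈ [0,1]^k be a probability vector and let w' ∈ ℝ^k satisfy Σ_{i=1}^k w'_i = 1. Define I⁻ = {i : w'_i < 0}, I⁺ = {i : w'_i ≥ 0}, W⁻ = Σ_{i∈I⁻} w'_i, W⁺ = Σ_{i∈I⁺} w'_i, and define w̃ ∈ ℝ^k by w̃_i = 0 for i ∈ I⁻ and w̃_i = w'_i·(1 + W⁻/W⁺) for i ∈ I⁺. Then: (i) Σ_{i=1}^k w̃_i = 1 and w̃_i ≥ 0 for all i; and (ii) ‖w̃ − w‖_∞ ≤ (k+1)·‖w' − w‖_∞. -/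
/-- (Rectifying the weights.)  Let `w` be a probability vector and
`w'` a real vector summing to `1`.  Let `W⁻` and `W⁺` be the sums of the negative and
nonnegative entries of `w'`, and define `w̃` by zeroing the negative entries and
scaling the nonnegative ones by `1 + W⁻/W⁺`.  Then `w̃` is a probability vector and
`‖w̃ - w‖_∞ ≤ (k+1) · ‖w' - w‖_∞`.  (The norm on `Fin k → ℝ` is the sup-norm.) -/
theorem rectify_weights
    (k : ℕ)
    (w : Fin k → ℝ) (hw : ∀ i, 0 ≤ w i) (hsum : ∑ i, w i = 1)
    (w' : Fin k → ℝ) (hsum' : ∑ i, w' i = 1)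
    (Wneg Wpos : ℝ)
    (hWneg : Wneg = ∑ i ∈ Finset.univ.filter (fun i => w' i < 0), w' i)
    (hWpos : Wpos = ∑ i ∈ Finset.univ.filter (fun i => 0 ≤ w' i), w' i)
    (wt : Fin k → ℝ)
    (hwt : ∀ i, wt i = if w' i < 0 then 0 else w' i * (1 + Wneg / Wpos)) :
    ((∑ i, wt i = 1) ∧ ∀ i, 0 ≤ wt i) ∧ ‖wt - w‖ ≤ (k + 1) * ‖w' - w‖ := by
  have hD0 : 0 ≤ ‖w' - w‖ := norm_nonneg _
  have hD : ∀ i, |w' i - w i| ≤ ‖w' - w‖ := fun i => by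
    simpa using norm_le_pi_norm (w' - w) i
  generalize ‖w' - w‖ = D at hD0 hD ⊢
  have hadd : Wneg + Wpos = 1 := by
    rw [hWneg, hWpos, ← hsum', Finset.sum_filter, Finset.sum_filter, ← Finset.sum_add_distrib]
    refine Finset.sum_congr rfl fun i _ => ?_
    by_cases h : w' i < 0
    · simp [h, not_le.mpr h]
    · simp [h, not_lt.mp h]
  have hneg : Wneg ≤ 0 := by
    rw [hWneg]
    exact Finset.sum_nonpos fun i hi => (Finset.mem_filter.mp hi).2.le
  have hpos : 0 < Wpos := by linarith
  have hfac : 1 + Wneg / Wpos = 1 / Wpos := by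
    field_simp
    linarith
  have hlow : -(k * D) ≤ Wneg := by
    have h1 : ∑ _i : Fin k, (-D) ≤ Wneg := by
      rw [hWneg, Finset.sum_filter]
      refine Finset.sum_le_sum fun i _ => ?_
      have := abs_le.mp (hD i)
      have := hw i
      split_ifs <;> linarith
    simpa using h1
  have hkD : 0 ≤ (k : ℝ) * D := by positivity
  refine ⟨⟨?_, ?_⟩, ?_⟩
  · have h1 : ∑ i, wt i = Wpos * (1 / Wpos) := by
      rw [← hfac]
      conv_rhs => rw [hWpos, Finset.sum_mul, Finset.sum_filter, ← hWpos]
      refine Finset.sum_congr rfl fun i _ => ?_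
      rw [hwt]
      by_cases h : w' i < 0
      · simp [h, not_le.mpr h]
      · simp [h, not_lt.mp h]
    rw [h1]
    field_simp
  · intro i
    rw [hwt, hfac]
    split_ifs with h
    · exact le_rfl
    · have := not_lt.mp h
      positivity
  · refine (pi_norm_le_iff_of_nonneg (by positivity)).mpr fun i => ?_
    have h1 := abs_le.mp (hD i)
    have h2 := hw i
    rw [Pi.sub_apply, Real.norm_eq_abs, hwt, abs_le]
    split_ifs with h
    · constructor <;> linarith
    · have h3 := not_lt.mp h
      have h4 : w' i ≤ Wpos := by
        rw [hWpos]
        exact Finset.single_le_sum (f := w') (fun j hj => (Finset.mem_filter.mp hj).2)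
          (Finset.mem_filter.mpr ⟨Finset.mem_univ i, h3⟩)
      have h5 : w' i / Wpos ≤ 1 := (div_le_one hpos).mpr h4
      have h6 : 0 ≤ w' i / Wpos := by positivity
      have h7 : w' i * (1 + Wneg / Wpos) = w' i + (w' i / Wpos) * Wneg := by ring
      have h8 : (w' i / Wpos) * Wneg ≤ 0 := mul_nonpos_of_nonneg_of_nonpos h6 hneg
      have h9 : Wneg ≤ (w' i / Wpos) * Wneg := by nlinarith
      rw [h7]
      constructor <;> linarith
end

section
/- Let α ∈ [0,1]^k have pairwise distances at least ζ > 0, let w ∈ ℝ^k be a probability vector, and let μ = V_α w where V_α is the k×k Vandermonde matrix with entries (V_α)_{ij} = α_j^i. Let α̃ ∈ [0,1]^k with V_{α̃} invertible, let μ̃ ∈ ℝ^k with μ̃₀ = 1, set w' = V_{α̃}^{-1} μ̃, and let w̃ be the rectification of w' (negative entries set to zero, nonnegative entries scaled by (1 + W⁻/W⁺) where W⁻, W⁺ are the sums of the negative and nonnegative entries of w'). Then ‖w̃ − w‖_∞ ≤ ((k+1)²·2^k / ζ^{k−1}) · max{‖α̃ − α‖_∞, ‖μ̃ − μ‖_∞}.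 -/
open Matrix

lemma fwr_pow_diff (a b : ℝ) (ha : a ∈ Set.Icc (0:ℝ) 1) (hb : b ∈ Set.Icc (0:ℝ) 1) (n : ℕ) :
    |a ^ n - b ^ n| ≤ n * |a - b| := by
  induction n with
  | zero => simp
  | succ n ih =>
    have h1 : a ^ (n+1) - b ^ (n+1) = a * (a ^ n - b ^ n) + b ^ n * (a - b) := by ring
    rw [h1]
    have h2 := abs_add_le (a * (a ^ n - b ^ n)) (b ^ n * (a - b))
    rw [abs_mul, abs_mul, abs_of_nonneg ha.1, abs_of_nonneg (pow_nonneg hb.1 n)] at h2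
    have h3 : a * |a ^ n - b ^ n| ≤ |a ^ n - b ^ n| :=
      mul_le_of_le_one_left (abs_nonneg _) ha.2
    have h4 : b ^ n * |a - b| ≤ |a - b| :=
      mul_le_of_le_one_left (abs_nonneg _) (pow_le_one₀ hb.1 hb.2)
    push_cast
    linarith

lemma fwr_moment {k : ℕ} (a d : Fin k → ℝ) (ha : ∀ i, a i ∈ Set.Icc (0:ℝ) 1) (δ : ℝ)
    (hM : ∀ n < k, |∑ j, d j * a j ^ n| ≤ δ) (s : Finset (Fin k)) :
    ∀ r, r + s.card < k →
      |∑ j, d j * (a j ^ r * ∏ b ∈ s, (a j - a b))| ≤ 2 ^ s.card * δ := by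
  induction s using Finset.induction_on with
  | empty => intro r hr; simpa using hM r (by simpa using hr)
  | insert b s hb ih =>
    intro r hr
    rw [Finset.card_insert_of_notMem hb] at hr ⊢
    have e : ∑ j, d j * (a j ^ r * ∏ c ∈ insert b s, (a j - a c))
        = ∑ j, d j * (a j ^ (r+1) * ∏ c ∈ s, (a j - a c))
          - a b * ∑ j, d j * (a j ^ r * ∏ c ∈ s, (a j - a c)) := by
      rw [Finset.mul_sum, ← Finset.sum_sub_distrib]
      refine Finset.sum_congr rfl fun j _ => ?_
      rw [Finset.prod_insert hb]; ring
    rw [e]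
    have h1 := ih (r+1) (by omega)
    have h2 := ih r (by omega)
    have h3 := abs_sub (∑ j, d j * (a j ^ (r+1) * ∏ c ∈ s, (a j - a c)))
      (a b * ∑ j, d j * (a j ^ r * ∏ c ∈ s, (a j - a c)))
    rw [abs_mul, abs_of_nonneg (ha b).1] at h3
    have h4 := mul_le_of_le_one_left (abs_nonneg (∑ j, d j * (a j ^ r * ∏ c ∈ s, (a j - a c)))) (ha b).2
    rw [pow_succ]
    linarith

lemma fwr_inv {k : ℕ} (a d : Fin k → ℝ) (ha : ∀ i, a i ∈ Set.Icc (0:ℝ) 1) (δ : ℝ)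
    (hM : ∀ n < k, |∑ j, d j * a j ^ n| ≤ δ) (ξ : ℝ) (hξ : 0 ≤ ξ)
    (hsep : ∀ i j, i ≠ j → ξ ≤ |a i - a j|) (i : Fin k) :
    |d i| * ξ ^ (k-1) ≤ 2 ^ (k-1) * δ := by
  have hc : (Finset.univ.erase i).card = k - 1 := by simp
  have h := fwr_moment a d ha δ hM (Finset.univ.erase i) 0 (by rw [hc]; have := i.2; omega)
  rw [Finset.sum_eq_single i, hc, pow_zero, one_mul, abs_mul, Finset.abs_prod] at h
  · refine le_trans (mul_le_mul_of_nonneg_left ?_ (abs_nonneg _)) h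
    rw [← hc, ← Finset.prod_const]
    refine Finset.prod_le_prod (fun _ _ => hξ) fun j hj => hsep i j ?_
    exact (Finset.ne_of_mem_erase hj).symm
  · intro j _ hj
    rw [Finset.prod_eq_zero (i := j) (by simp [hj]) (sub_self _)]; simp
  · simp

/-- (Full weight reconstruction.)  Let `α ∈ [0,1]^k` be
`ζ`-separated, `w` a probability vector, `μ = V_α w`.  Let `α̃ ∈ [0,1]^k` with `V_α̃`
invertible, let `μ̃` have first entry `1`, set `w' = V_α̃⁻¹ μ̃`, and let `w̃` be the
rectification of `w'`.  Then
`‖w̃ - w‖_∞ ≤ ((k+1)² · 2^k / ζ^(k-1)) · max {‖α̃ - α‖_∞, ‖μ̃ - μ‖_∞}`. -/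
theorem full_weight_reconstruction
    (k : ℕ) (hk : 0 < k)
    (α : Fin k → ℝ) (hα : ∀ i, α i ∈ Set.Icc (0 : ℝ) 1)
    (ζ : ℝ) (hζ : 0 < ζ)
    (hsep : ∀ i j, i ≠ j → ζ ≤ |α i - α j|)
    (w : Fin k → ℝ) (hw : ∀ i, 0 ≤ w i) (hsum : ∑ i, w i = 1)
    (V : Matrix (Fin k) (Fin k) ℝ) (hV : ∀ i j, V i j = α j ^ (i : ℕ))
    (μ : Fin k → ℝ) (hμ : μ = V.mulVec w)
    (αt : Fin k → ℝ) (hαt : ∀ i, αt i ∈ Set.Icc (0 : ℝ) 1)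
    (Vt : Matrix (Fin k) (Fin k) ℝ) (hVt : ∀ i j, Vt i j = αt j ^ (i : ℕ))
    (hinv : IsUnit Vt.det)
    (μt : Fin k → ℝ) (hμt0 : μt ⟨0, hk⟩ = 1)
    (w' : Fin k → ℝ) (hw' : w' = Vt⁻¹.mulVec μt)
    (Wneg Wpos : ℝ)
    (hWneg : Wneg = ∑ i ∈ Finset.univ.filter (fun i => w' i < 0), w' i)
    (hWpos : Wpos = ∑ i ∈ Finset.univ.filter (fun i => 0 ≤ w' i), w' i)
    (wt : Fin k → ℝ)
    (hwt : ∀ i, wt i = if w' i < 0 then 0 else w' i * (1 + Wneg / Wpos)) :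
    ‖wt - w‖ ≤ (k + 1) ^ 2 * 2 ^ k / ζ ^ (k - 1) * max ‖αt - α‖ ‖μt - μ‖ := by
  set ε := max ‖αt - α‖ ‖μt - μ‖ with hε
  have hε0 : 0 ≤ ε := le_max_of_le_left (norm_nonneg _)
  have hεα : ∀ i, |αt i - α i| ≤ ε := fun i =>
    (norm_le_pi_norm (αt - α) i).trans (le_max_left _ _)
  have hεμ : ∀ i, |μt i - μ i| ≤ ε := fun i =>
    (norm_le_pi_norm (μt - μ) i).trans (le_max_right _ _)
  have hk1 : (1:ℝ) ≤ k := by exact_mod_cast hk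
  have hVw : Vt.mulVec w' = μt := by
    rw [hw', Matrix.mulVec_mulVec, Matrix.mul_nonsing_inv _ hinv, Matrix.one_mulVec]
  have hmt : ∀ i : Fin k, ∑ j, w' j * αt j ^ (i:ℕ) = μt i := by
    intro i
    rw [← hVw]
    simp [Matrix.mulVec, dotProduct, hVt, mul_comm]
  have hm : ∀ i : Fin k, ∑ j, w j * α j ^ (i:ℕ) = μ i := by
    intro i
    rw [hμ]
    simp [Matrix.mulVec, dotProduct, hV, mul_comm]
  have hs' : ∑ j, w' j = 1 := by
    have := hmt ⟨0, hk⟩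
    rw [hμt0] at this
    simpa using this
  have hsplit : Wneg + Wpos = 1 := by
    rw [hWneg, hWpos, ← hs', ← Finset.sum_filter_add_sum_filter_not Finset.univ (fun i => w' i < 0)]
    simp
  have hneg0 : Wneg ≤ 0 := by
    rw [hWneg]
    exact Finset.sum_nonpos fun i hi => (Finset.mem_filter.1 hi).2.le
  have hpos : 1 ≤ Wpos := by linarith
  have hfac : 1 + Wneg / Wpos = 1 / Wpos := by
    field_simp; linarith
  have hle : ∀ i, 0 ≤ w' i → w' i ≤ Wpos := by
    intro i hi
    rw [hWpos]
    exact Finset.single_le_sum (f := w') (fun j hj => (Finset.mem_filter.1 hj).2)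
      (Finset.mem_filter.2 ⟨Finset.mem_univ i, hi⟩)
  have hζp : 0 < ζ ^ (k-1) := pow_pos hζ _
  have hC0 : 0 ≤ ((k:ℝ) + 1) ^ 2 * 2 ^ k / ζ ^ (k - 1) := by positivity
  have hw1 : ∀ i, w i ≤ 1 := fun i => by
    rw [← hsum]; exact Finset.single_le_sum (fun j _ => hw j) (Finset.mem_univ i)
  by_cases hbig : 1 ≤ ((k:ℝ) + 1) ^ 2 * 2 ^ k / ζ ^ (k - 1) * ε
  · refine le_trans ?_ hbig
    refine (pi_norm_le_iff_of_nonneg zero_le_one).2 fun i => ?_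
    rw [Pi.sub_apply, Real.norm_eq_abs, hwt i, abs_le]
    have a1 := hw i
    have a2 := hw1 i
    split_ifs with h
    · constructor <;> linarith
    · push Not at h
      rw [hfac, mul_one_div]
      have b1 : 0 ≤ w' i / Wpos := by positivity
      have b2 : w' i / Wpos ≤ 1 := (div_le_one (by linarith)).2 (hle i h)
      constructor <;> linarith
  push Not at hbig
  have hbig' : ((k:ℝ) + 1) ^ 2 * 2 ^ k * ε < ζ ^ (k-1) := by
    rw [div_mul_eq_mul_div, div_lt_one hζp] at hbig
    exact hbig
  -- separation of αt
  set ξ := ζ * (1 - 1 / (2 * k)) with hξd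
  have hx1 : 1 / (2 * (k:ℝ)) ≤ 1 / 2 := by
    apply one_div_le_one_div_of_le <;> linarith
  have hξ0 : 0 ≤ ξ := mul_nonneg hζ.le (by linarith)
  have hsept : ∀ i j, i ≠ j → ξ ≤ |αt i - αt j| := by
    intro i j hij
    have h1 := hsep i j hij
    have hz1 : ζ ≤ 1 := h1.trans (abs_le.2 ⟨by linarith [(hα i).1, (hα j).2], by linarith [(hα i).2, (hα j).1]⟩)
    have hk2 : k - 1 ≠ 0 := by
      intro h
      apply hij; ext; have := i.2; have := j.2; omega
    have hzz : ζ ^ (k-1) ≤ ζ := pow_le_of_le_one hζ.le hz1 hk2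
    have h2k : (1:ℝ) ≤ 2 ^ k := one_le_pow₀ (by norm_num)
    have h4 : 4 * k * ε ≤ ζ := by
      have : 4 * (k:ℝ) ≤ (k + 1) ^ 2 * 2 ^ k := by
        nlinarith [sq_nonneg ((k:ℝ) - 1), sq_nonneg ((k:ℝ)+1)]
      have := mul_le_mul_of_nonneg_right this hε0
      linarith
    have h5 : ξ ≤ ζ - 2 * ε := by
      have : 2 * ε ≤ ζ * (1 / (2 * k)) := by
        rw [mul_one_div, le_div_iff₀ (by linarith)]; linarith
      rw [hξd]; linarith
    have h6 : |α i - α j| ≤ |αt i - αt j| + |αt i - α i| + |αt j - α j| := by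
      have e : α i - α j = (αt i - αt j) - (αt i - α i) + (αt j - α j) := by ring
      have t1 := abs_add_le ((αt i - αt j) - (αt i - α i)) (αt j - α j)
      have t2 := abs_sub (αt i - αt j) (αt i - α i)
      rw [← e] at t1
      linarith
    linarith [hεα i, hεα j]
  have hξp : ζ ^ (k-1) / 2 ≤ ξ ^ (k-1) := by
    have hb := one_add_mul_le_pow (a := -(1 / (2 * (k:ℝ)))) (by linarith) (k-1)
    have hc : ((k - 1 : ℕ) : ℝ) = k - 1 := by rw [Nat.cast_sub hk]; simp
    have h3 : (1:ℝ)/2 ≤ 1 + ((k-1 : ℕ):ℝ) * -(1 / (2 * (k:ℝ))) := by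
      rw [hc]
      have : ((k:ℝ) - 1) * (1 / (2 * k)) ≤ 1 / 2 := by
        rw [mul_one_div, div_le_iff₀ (by linarith)]; linarith
      linarith
    rw [hξd, mul_pow, sub_eq_add_neg]
    have := mul_le_mul_of_nonneg_left (h3.trans hb) hζp.le
    linarith
  have hM : ∀ n < k, |∑ j, (w' j - w j) * αt j ^ n| ≤ k * ε := by
    intro n hn
    have e : ∑ j, (w' j - w j) * αt j ^ n
        = (μt ⟨n, hn⟩ - μ ⟨n, hn⟩) - ∑ j, w j * (αt j ^ n - α j ^ n) := by
      rw [← hmt, ← hm, ← Finset.sum_sub_distrib, ← Finset.sum_sub_distrib]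
      exact Finset.sum_congr rfl fun j _ => by ring
    have h1 : |∑ j, w j * (αt j ^ n - α j ^ n)| ≤ n * ε := by
      refine (Finset.abs_sum_le_sum_abs _ _).trans ?_
      calc ∑ j, |w j * (αt j ^ n - α j ^ n)| ≤ ∑ j, w j * (n * ε) := by
            refine Finset.sum_le_sum fun j _ => ?_
            rw [abs_mul, abs_of_nonneg (hw j)]
            refine mul_le_mul_of_nonneg_left ?_ (hw j)
            exact (fwr_pow_diff _ _ (hαt j) (hα j) n).trans
              (mul_le_mul_of_nonneg_left (hεα j) (Nat.cast_nonneg n))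
        _ = n * ε := by rw [← Finset.sum_mul, hsum, one_mul]
    rw [e]
    have h2 := abs_sub (μt ⟨n, hn⟩ - μ ⟨n, hn⟩) (∑ j, w j * (αt j ^ n - α j ^ n))
    have h3 := hεμ ⟨n, hn⟩
    have h4 : (n:ℝ) + 1 ≤ k := by exact_mod_cast hn
    have h5 := mul_le_mul_of_nonneg_right h4 hε0
    linarith
  set e := k * 2 ^ k * ε / ζ ^ (k-1) with he
  have he0 : 0 ≤ e := by positivity
  have hd : ∀ i, |w' i - w i| ≤ e := by
    intro i
    have h := fwr_inv αt (fun j => w' j - w j) hαt (k * ε) hM ξ hξ0 hsept i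
    have h2 := mul_le_mul_of_nonneg_left hξp (abs_nonneg (w' i - w i))
    have h3 : (2:ℝ) ^ k = 2 * 2 ^ (k-1) := by
      rw [← pow_succ']; congr 1; omega
    rw [he, le_div_iff₀ hζp, h3]
    linarith
  have hke : k * e ≤ ((k:ℝ) + 1) ^ 2 * 2 ^ k / ζ ^ (k - 1) * ε := by
    have : k * e = (k:ℝ) ^ 2 * (2 ^ k / ζ ^ (k-1) * ε) := by rw [he]; ring
    rw [this]
    have h2 : ((k:ℝ) + 1) ^ 2 * 2 ^ k / ζ ^ (k - 1) * ε = ((k:ℝ)+1) ^ 2 * (2 ^ k / ζ ^ (k-1) * ε) := by ring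
    rw [h2]
    refine mul_le_mul_of_nonneg_right ?_ (by positivity)
    nlinarith
  have heke : e ≤ k * e := le_mul_of_one_le_left he0 hk1
  refine le_trans ?_ hke
  refine (pi_norm_le_iff_of_nonneg (he0.trans heke)).2 fun i => ?_
  rw [Pi.sub_apply, Real.norm_eq_abs, hwt i, abs_le]
  have hdi := abs_le.1 (hd i)
  have a1 := hw i
  split_ifs with h
  · constructor <;> linarith [hdi.1]
  · push Not at h
    have hWn : -Wneg ≤ (k - 1) * e := by
      rw [hWneg, ← Finset.sum_neg_distrib]
      have h1 : ∑ j ∈ Finset.univ.filter (fun i => w' i < 0), -w' j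
          ≤ ∑ j ∈ Finset.univ.filter (fun i => w' i < 0), e := by
        refine Finset.sum_le_sum fun j _ => ?_
        have := (abs_le.1 (hd j)).1
        linarith [hw j]
      rw [Finset.sum_const, nsmul_eq_mul] at h1
      refine h1.trans (mul_le_mul_of_nonneg_right ?_ he0)
      have h2 : (Finset.univ.filter (fun i => w' i < 0)).card < k := by
        have := Finset.card_lt_card (s := Finset.univ.filter (fun i => w' i < 0))
          (t := Finset.univ) (Finset.filter_ssubset.2 ⟨i, Finset.mem_univ i, not_lt.2 h⟩)
        simpa using this
      have h3 : ((Finset.univ.filter (fun i => w' i < 0)).card : ℝ) + 1 ≤ k := by exact_mod_cast h2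
      linarith
    have e1 : w' i * (1 + Wneg / Wpos) = w' i + (w' i / Wpos) * Wneg := by ring
    have b1 : 0 ≤ w' i / Wpos := by positivity
    have b2 : w' i / Wpos ≤ 1 := (div_le_one (by linarith)).2 (hle i h)
    have b3 : (w' i / Wpos) * Wneg ≤ 0 := mul_nonpos_of_nonneg_of_nonpos b1 hneg0
    have b4 : Wneg ≤ (w' i / Wpos) * Wneg := by nlinarith
    rw [e1]
    constructor <;> linarith [hdi.1, hdi.2]
end

section
/- Let A and B be n×n real symmetric matrices with eigenvalues κ₁ ≤ … ≤ κ_n and λ₁ ≤ … ≤ λ_n respectively, let u₁ be a unit eigenvector of A for κ₁ and v₁ a unit eigenvector of B for λ₁, and set P = B − A. If ‖P‖ < |κ₁ − λ₂| (where ‖·‖ is the Frobenius norm), then |u₁ᵀ v₁| ≥ √(1 − ‖P‖² / |κ₁ − λ₂|²). -/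
open Matrix

/-- The eigenvalues of a real symmetric matrix, sorted in increasing order
(with multiplicity), as a list. -/
noncomputable def sortedEigenvalues {n : ℕ} {A : Matrix (Fin n) (Fin n) ℝ}
    (hA : A.IsHermitian) : List ℝ :=
  (Finset.univ.val.map hA.eigenvalues).sort (· ≤ ·)

lemma dk_sorted {n : ℕ} (hn : 2 ≤ n) {A : Matrix (Fin n) (Fin n) ℝ} (hA : A.IsHermitian) :
    ∃ i₀, hA.eigenvalues i₀ = (sortedEigenvalues hA)[0]! ∧
      (sortedEigenvalues hA)[0]! ≤ (sortedEigenvalues hA)[1]! ∧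
      ∀ i, i ≠ i₀ → (sortedEigenvalues hA)[1]! ≤ hA.eigenvalues i := by
  have hs : (sortedEigenvalues hA).Pairwise (· ≤ ·) := Multiset.pairwise_sort _ _
  have he : ((sortedEigenvalues hA : List ℝ) : Multiset ℝ) =
      Finset.univ.val.map hA.eigenvalues := Multiset.sort_eq _ _
  have hl : (sortedEigenvalues hA).length = n := by
    have := congrArg Multiset.card he
    simpa using this
  generalize sortedEigenvalues hA = L at *
  match L, hs, he, hl with
  | [], _, _, hl => simp at hl; omega
  | [a], _, _, hl => simp at hl; omega
  | a :: b :: l, hs, he, hl =>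
    have ha : a ∈ Finset.univ.val.map hA.eigenvalues := by rw [← he]; simp
    obtain ⟨i₀, _, hi₀⟩ := Multiset.mem_map.1 ha
    refine ⟨i₀, by simpa using hi₀, ?_, ?_⟩
    · simp only [List.pairwise_cons] at hs
      simpa using hs.1 b (by simp)
    · intro i hi
      have h1 : (Finset.univ : Finset (Fin n)).val = i₀ ::ₘ (Finset.univ.val.erase i₀) :=
        (Multiset.cons_erase (Finset.mem_univ i₀)).symm
      rw [h1, Multiset.map_cons, hi₀, ← Multiset.cons_coe, Multiset.cons_inj_right] at he
      have h2 : hA.eigenvalues i ∈ ((b :: l : List ℝ) : Multiset ℝ) := by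
        rw [he]
        exact Multiset.mem_map_of_mem _ ((Multiset.mem_erase_of_ne hi).2 (Finset.mem_univ i))
      simp only [List.pairwise_cons] at hs
      have h3 : hA.eigenvalues i ∈ b :: l := by simpa using h2
      rcases List.mem_cons.1 h3 with h | h
      · simp [h]
      · simpa using hs.2.1 _ h

lemma dk_basis {n : ℕ} {A : Matrix (Fin n) (Fin n) ℝ} (hA : A.IsHermitian) :
    ∃ e : Fin n → Fin n → ℝ, (∀ i x, e i ⬝ᵥ (A *ᵥ x) = hA.eigenvalues i * (e i ⬝ᵥ x)) ∧
      ∀ x y, x ⬝ᵥ y = ∑ i, (e i ⬝ᵥ x) * (e i ⬝ᵥ y) := by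
  refine ⟨fun i => (hA.eigenvectorBasis i).ofLp, ?_, ?_⟩
  · intro i x
    have h := hA.mulVec_eigenvectorBasis i
    have ht : Aᵀ = A := by simpa using hA.eq
    rw [dotProduct_mulVec, ← mulVec_transpose, ht, h, smul_dotProduct, smul_eq_mul]
  · intro x y
    have h := hA.eigenvectorBasis.sum_inner_mul_inner (WithLp.toLp 2 x) (WithLp.toLp 2 y)
    simp only [EuclideanSpace.inner_eq_star_dotProduct, star_trivial] at h
    rw [dotProduct_comm x y, ← h]
    refine Finset.sum_congr rfl fun i _ => ?_
    rw [dotProduct_comm y]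

lemma dk_quad {n : ℕ} {A : Matrix (Fin n) (Fin n) ℝ} (hA : A.IsHermitian) (hn : 2 ≤ n)
    (x : Fin n → ℝ) : (sortedEigenvalues hA)[0]! * (x ⬝ᵥ x) ≤ x ⬝ᵥ (A *ᵥ x) := by
  obtain ⟨i₀, h0, h01, h1⟩ := dk_sorted hn hA
  obtain ⟨e, he, hp⟩ := dk_basis hA
  rw [hp x x, hp x (A *ᵥ x), Finset.mul_sum]
  refine Finset.sum_le_sum fun i _ => ?_
  rw [he]
  have : (sortedEigenvalues hA)[0]! ≤ hA.eigenvalues i := by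
    by_cases h : i = i₀
    · rw [h, h0]
    · exact h01.trans (h1 i h)
  nlinarith [mul_self_nonneg (e i ⬝ᵥ x)]

lemma dk_quad2 {n : ℕ} {A : Matrix (Fin n) (Fin n) ℝ} (hA : A.IsHermitian) (hn : 2 ≤ n)
    (v x : Fin n → ℝ) (hv : A *ᵥ v = (sortedEigenvalues hA)[0]! • v) (hv1 : v ⬝ᵥ v = 1)
    (hx : v ⬝ᵥ x = 0) : (sortedEigenvalues hA)[1]! * (x ⬝ᵥ x) ≤ x ⬝ᵥ (A *ᵥ x) := by
  have hq := dk_quad hA hn x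
  obtain ⟨i₀, h0, h01, h1⟩ := dk_sorted hn hA
  rcases h01.eq_or_lt with h | hlt
  · rwa [← h]
  obtain ⟨e, he, hp⟩ := dk_basis hA
  have hz : ∀ i, i ≠ i₀ → e i ⬝ᵥ v = 0 := by
    intro i hi
    have h2 := he i v
    rw [hv, dotProduct_smul, smul_eq_mul] at h2
    have h3 := h1 i hi
    have : (hA.eigenvalues i - (sortedEigenvalues hA)[0]!) * (e i ⬝ᵥ v) = 0 := by linarith
    rcases mul_eq_zero.1 this with h | h
    · linarith
    · exact h
  have hsum : ∀ y, v ⬝ᵥ y = (e i₀ ⬝ᵥ v) * (e i₀ ⬝ᵥ y) := by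
    intro y
    rw [hp v y]
    refine Finset.sum_eq_single i₀ (fun i _ hi => by rw [hz i hi, zero_mul]) (by simp)
  have hx0 : e i₀ ⬝ᵥ x = 0 := by
    rw [hsum] at hv1 hx
    rcases mul_eq_zero.1 hx with h | h
    · rw [h] at hv1; simp at hv1
    · exact h
  rw [hp x x, hp x (A *ᵥ x), Finset.mul_sum]
  refine Finset.sum_le_sum fun i _ => ?_
  rw [he]
  by_cases h : i = i₀
  · rw [h, hx0]; simp
  · nlinarith [mul_self_nonneg (e i ⬝ᵥ x), h1 i h]

lemma dk_cs {n : ℕ} (x y : Fin n → ℝ) : (x ⬝ᵥ y) ^ 2 ≤ (x ⬝ᵥ x) * (y ⬝ᵥ y) := by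
  have := Finset.sum_mul_sq_le_sq_mul_sq Finset.univ x y
  simpa [dotProduct, pow_two] using this

lemma dk_frob {n : ℕ} (P : Matrix (Fin n) (Fin n) ℝ) (x : Fin n → ℝ) (hx : x ⬝ᵥ x = 1) :
    (P *ᵥ x) ⬝ᵥ (P *ᵥ x) ≤ ∑ i, ∑ j, (P i j) ^ 2 := by
  unfold dotProduct
  refine Finset.sum_le_sum fun i _ => ?_
  have := dk_cs (P i) x
  rw [hx, mul_one] at this
  simpa [dotProduct, pow_two, mulVec] using this

/-- (Davis–Kahan, one-dimensional consequence.)  Let `A, B` be `n × n`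
real symmetric matrices, with `u₁` a unit eigenvector of `A` for its smallest eigenvalue
`κ₁` and `v₁` a unit eigenvector of `B` for its smallest eigenvalue `λ₁`.  If the
Frobenius norm of `P = B - A` is less than `|κ₁ - λ₂|`, where `λ₂` is the second
smallest eigenvalue of `B`, then `|u₁ᵀ v₁| ≥ √(1 - ‖P‖² / |κ₁ - λ₂|²)`. -/
theorem davis_kahan_one_dim
    (n : ℕ) (hn : 2 ≤ n)
    (A B : Matrix (Fin n) (Fin n) ℝ) (hA : A.IsHermitian) (hB : B.IsHermitian)
    (u₁ v₁ : Fin n → ℝ)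
    (hu : A.mulVec u₁ = (sortedEigenvalues hA)[0]! • u₁) (huunit : ∑ i, (u₁ i) ^ 2 = 1)
    (hv : B.mulVec v₁ = (sortedEigenvalues hB)[0]! • v₁) (hvunit : ∑ i, (v₁ i) ^ 2 = 1)
    (hgap : Real.sqrt (∑ i, ∑ j, ((B - A) i j) ^ 2) <
      |(sortedEigenvalues hA)[0]! - (sortedEigenvalues hB)[1]!|) :
    Real.sqrt (1 - (∑ i, ∑ j, ((B - A) i j) ^ 2) /
        |(sortedEigenvalues hA)[0]! - (sortedEigenvalues hB)[1]!| ^ 2) ≤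
      |u₁ ⬝ᵥ v₁| := by
  have huu : u₁ ⬝ᵥ u₁ = 1 := by simpa [dotProduct, pow_two] using huunit
  have hvv : v₁ ⬝ᵥ v₁ = 1 := by simpa [dotProduct, pow_two] using hvunit
  have hFu := dk_frob (B - A) u₁ huu
  have hFv := dk_frob (B - A) v₁ hvv
  have hAv := dk_quad hA hn v₁
  have h01 : (sortedEigenvalues hB)[0]! ≤ (sortedEigenvalues hB)[1]! := by
    obtain ⟨_, _, h, _⟩ := dk_sorted hn hB
    exact h
  have hBw := dk_quad2 hB hn v₁ (u₁ - (u₁ ⬝ᵥ v₁) • v₁) hv hvv (by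
    simp [dotProduct_sub, dotProduct_smul, hvv, dotProduct_comm v₁ u₁])
  have hF0 : 0 ≤ ∑ i, ∑ j, ((B - A) i j) ^ 2 := by positivity
  generalize (∑ i, ∑ j, ((B - A) i j) ^ 2) = F at *
  generalize (sortedEigenvalues hA)[0]! = k at *
  generalize (sortedEigenvalues hB)[0]! = l1 at *
  generalize (sortedEigenvalues hB)[1]! = l2 at *
  have hs2 : Real.sqrt F ^ 2 = F := Real.sq_sqrt hF0
  have hs0 := Real.sqrt_nonneg F
  -- Weyl part: the bottom eigenvalue of A is at most l1 + norm of P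
  have hk : k ≤ l1 + Real.sqrt F := by
    have h1 := dk_cs v₁ ((B - A) *ᵥ v₁)
    rw [hvv, one_mul] at h1
    have h2 := abs_le_of_sq_le_sq' ((h1.trans hFv).trans hs2.ge) hs0
    rw [sub_mulVec, hv, dotProduct_sub, dotProduct_smul, hvv, smul_eq_mul] at h2
    rw [hvv] at hAv
    linarith [h2.1]
  have hg : Real.sqrt F < l2 - k := by
    rcases lt_abs.1 hgap with h | h <;> linarith
  have hd : 0 < l2 - k := hs0.trans_lt hg
  rw [sq_abs]
  set c := u₁ ⬝ᵥ v₁ with hc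
  set w := u₁ - c • v₁ with hw
  have hwv : w ⬝ᵥ v₁ = 0 := by
    simp [hw, sub_dotProduct, smul_dotProduct, hvv, ← hc]
  have hww : w ⬝ᵥ w = 1 - c ^ 2 := by
    have : w ⬝ᵥ w = w ⬝ᵥ u₁ - c * (w ⬝ᵥ v₁) := by
      conv_lhs => rw [hw, dotProduct_sub, dotProduct_smul, smul_eq_mul, ← hw]
    rw [this, hwv, hw, sub_dotProduct, smul_dotProduct, huu, dotProduct_comm v₁ u₁, ← hc]
    simp; ring
  have hPu : (B - A) *ᵥ u₁ = B *ᵥ w - k • w + (c * (l1 - k)) • v₁ := by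
    rw [sub_mulVec, hu, hw, mulVec_sub, mulVec_smul, hv]
    ext i
    simp
    ring
  have h1 : w ⬝ᵥ ((B - A) *ᵥ u₁) = w ⬝ᵥ (B *ᵥ w) - k * (w ⬝ᵥ w) := by
    rw [hPu, dotProduct_add, dotProduct_sub, dotProduct_smul, dotProduct_smul, hwv]
    simp
  have h2 := dk_cs w ((B - A) *ᵥ u₁)
  rw [h1] at h2
  have hw0 : 0 ≤ w ⬝ᵥ w := by
    rw [dotProduct]; exact Finset.sum_nonneg fun i _ => mul_self_nonneg _
  generalize w ⬝ᵥ (B *ᵥ w) = q at *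
  have h3 : (l2 - k) * (w ⬝ᵥ w) ≤ q - k * (w ⬝ᵥ w) := by linarith
  have h4 : ((l2 - k) * (w ⬝ᵥ w)) ^ 2 ≤ (w ⬝ᵥ w) * F :=
    (pow_le_pow_left₀ (by positivity) h3 2).trans
      (h2.trans (mul_le_mul_of_nonneg_left hFu hw0))
  have h5 : (l2 - k) ^ 2 * (w ⬝ᵥ w) ≤ F := by
    rcases hw0.eq_or_lt with h | h
    · rw [← h]; simpa using hF0
    · refine le_of_mul_le_mul_left ?_ h
      linarith
  apply Real.sqrt_le_iff.2 ⟨abs_nonneg _, ?_⟩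
  rw [sq_abs]
  have h6 : w ⬝ᵥ w ≤ F / (k - l2) ^ 2 := by
    rw [le_div_iff₀ (by nlinarith)]
    linarith
  linarith
end
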